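/- For every countable ordinal ξ with 1 ≤ ξ < ω₁, there exists a set A ⊆ 2^{<ω} such that the ω-power A^∞ is Σ^0_ξ-complete; in particular A^∞ ∈ Σ^0_ξ(2^ω) \ Π^0_ξ(2^ω). -/

import Mathlib

open Topology MeasureTheory TopologicalSpace

abbrev Cantor : Type := ℕ → Fin 2

/-- The concatenation of the first `m` words of the sequence `a`. -/
def concatPrefix {β : Type*} (a : ℕ → List β) (m : ℕ) : List β :=
  ((List.range m).map a).flatten

/-- The ω-power of a set `A` of finite words: the set of all infinite words obtained by
concatenating a sequence of words of `A` (infinitely many of them being nonempty). -/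
def omegaPower {β : Type*} (A : Set (List β)) : Set (ℕ → β) :=
  {α | ∃ a : ℕ → List β, (∀ i, a i ∈ A) ∧
    (∀ n, ∃ m, n ≤ (concatPrefix a m).length) ∧
    ∀ (m k : ℕ) (h : k < (concatPrefix a m).length), (concatPrefix a m).get ⟨k, h⟩ = α k}

/-- The Borel class Σ⁰_ξ of a topological space: Σ⁰_ξ is the class of open sets for ξ ≤ 1,
and for ξ ≥ 2 it consists of the countable unions of sets each lying in some Π⁰_η
with 1 ≤ η < ξ. -/
noncomputable def SigmaZero (X : Type*) [TopologicalSpace X] (ξ : Ordinal.{0}) : Set (Set X) :=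
  if ξ ≤ 1 then {s | IsOpen s}
  else {s | ∃ f : ℕ → Set X,
    (∀ n, ∃ η : Ordinal.{0}, ∃ _ : 1 ≤ η, ∃ _ : η < ξ, (f n)ᶜ ∈ SigmaZero X η) ∧
    s = ⋃ n, f n}
termination_by ξ

/-- The Borel class Π⁰_ξ: complements of Σ⁰_ξ sets. -/
noncomputable def PiZero (X : Type*) [TopologicalSpace X] (ξ : Ordinal.{0}) : Set (Set X) :=
  {s | sᶜ ∈ SigmaZero X ξ}

/-- A topological space is zero-dimensional if it has a basis consisting of clopen sets. -/
def ZeroDim (X : Type*) [TopologicalSpace X] : Prop :=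
  ∃ b : Set (Set X), IsTopologicalBasis b ∧ ∀ s ∈ b, IsClopen s

section BorelClasses

variable {X Y : Type*} [TopologicalSpace X] [TopologicalSpace Y] {ξ η : Ordinal.{0}}

theorem mem_sigmaZero_of_le_one (hξ : ξ ≤ 1) {s : Set X} : s ∈ SigmaZero X ξ ↔ IsOpen s := by
  rw [SigmaZero, if_pos hξ]; rfl

theorem mem_sigmaZero_iff (hξ : 1 < ξ) {s : Set X} :
    s ∈ SigmaZero X ξ ↔ ∃ f : ℕ → Set X,
      (∀ n, ∃ η : Ordinal.{0}, 1 ≤ η ∧ η < ξ ∧ (f n)ᶜ ∈ SigmaZero X η) ∧ s = ⋃ n, f n := by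
  rw [SigmaZero, if_neg (not_le.2 hξ)]
  simp only [exists_prop]
  rfl

theorem SigmaZero.preimage {g : X → Y} (hg : Continuous g) {s : Set Y}
    (hs : s ∈ SigmaZero Y ξ) : g ⁻¹' s ∈ SigmaZero X ξ := by
  induction ξ using WellFoundedLT.induction generalizing s with
  | ind ξ ih =>
    rcases le_or_gt ξ 1 with h | h
    · rw [mem_sigmaZero_of_le_one h] at hs ⊢
      exact hs.preimage hg
    · rw [mem_sigmaZero_iff h] at hs ⊢
      obtain ⟨f, hf, rfl⟩ := hs
      refine ⟨fun n => g ⁻¹' f n, fun n => ?_, by simp⟩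
      obtain ⟨η, h1, h2, h3⟩ := hf n
      exact ⟨η, h1, h2, ih η h2 h3⟩

theorem SigmaZero.iUnion_nat {s : ℕ → Set X} (hs : ∀ n, s n ∈ SigmaZero X ξ) :
    ⋃ n, s n ∈ SigmaZero X ξ := by
  rcases le_or_gt ξ 1 with h | h
  · simp only [mem_sigmaZero_of_le_one h] at hs ⊢
    exact isOpen_iUnion hs
  · simp only [mem_sigmaZero_iff h] at hs ⊢
    choose f hf hs using hs
    refine ⟨fun n => f n.unpair.1 n.unpair.2, fun n => hf _ _, ?_⟩
    rw [Set.iUnion_unpair]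
    exact Set.iUnion_congr hs

theorem PiZero.iInter_nat (hξ : 1 < ξ) {s : ℕ → Set X}
    (hs : ∀ n, ∃ η : Ordinal.{0}, 1 ≤ η ∧ η < ξ ∧ s n ∈ SigmaZero X η) :
    ⋂ n, s n ∈ PiZero X ξ := by
  refine (mem_sigmaZero_iff hξ).2 ⟨fun n => (s n)ᶜ, fun n => ?_, Set.compl_iInter _⟩
  simpa using hs n

theorem SigmaZero.of_isClosed (hξ : 1 < ξ) {s : Set X} (hs : IsClosed s) :
    s ∈ SigmaZero X ξ :=
  (mem_sigmaZero_iff hξ).2 ⟨fun _ => s, fun _ => ⟨1, le_rfl, hξ,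
    (mem_sigmaZero_of_le_one le_rfl).2 hs.isOpen_compl⟩, (Set.iUnion_const s).symm⟩

theorem SigmaZero.univ : Set.univ ∈ SigmaZero X ξ := by
  rcases le_or_gt ξ 1 with h | h
  · exact (mem_sigmaZero_of_le_one h).2 isOpen_univ
  · exact SigmaZero.of_isClosed h isClosed_univ

theorem SigmaZero.union {s t : Set X} (hs : s ∈ SigmaZero X ξ) (ht : t ∈ SigmaZero X ξ) :
    s ∪ t ∈ SigmaZero X ξ := by
  have : s ∪ t = ⋃ n : ℕ, if n = 0 then s else t := by
    ext x
    simp only [Set.mem_union, Set.mem_iUnion]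
    refine ⟨fun h => h.elim (fun h => ⟨0, by simpa⟩) fun h => ⟨1, by simpa⟩, ?_⟩
    rintro ⟨n, hn⟩
    split_ifs at hn <;> simp [hn]
  rw [this]
  refine SigmaZero.iUnion_nat fun n => ?_
  split_ifs <;> assumption

end BorelClasses

section Metrizable

variable {X : Type*} [TopologicalSpace X] [MetrizableSpace X] {ξ : Ordinal.{0}}

theorem SigmaZero.of_isOpen {s : Set X} (hs : IsOpen s) : s ∈ SigmaZero X ξ := by
  rcases le_or_gt ξ 1 with h | h
  · exact (mem_sigmaZero_of_le_one h).2 hs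
  · let _ := metrizableSpaceMetric X
    obtain ⟨F, hF, -, hU, -⟩ := hs.exists_iUnion_isClosed
    rw [← hU]
    exact SigmaZero.iUnion_nat fun n => SigmaZero.of_isClosed h (hF n)

theorem SigmaZero.inter_isClosed (hξ : 1 < ξ) {s t : Set X} (hs : s ∈ SigmaZero X ξ)
    (ht : IsClosed t) : t ∩ s ∈ SigmaZero X ξ := by
  rw [mem_sigmaZero_iff hξ] at hs ⊢
  obtain ⟨f, hf, rfl⟩ := hs
  refine ⟨fun n => t ∩ f n, fun n => ?_, Set.inter_iUnion _ _⟩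
  obtain ⟨η, h1, h2, h3⟩ := hf n
  refine ⟨η, h1, h2, ?_⟩
  rw [Set.compl_inter]
  exact SigmaZero.union (SigmaZero.of_isOpen ht.isOpen_compl) h3

end Metrizable

/-- Closed embeddings into products of discrete spaces send `Σ⁰_ξ` sets to `Σ⁰_ξ` sets, `ξ ≥ 2`. -/
theorem SigmaZero.image {E : ℕ → Type*} [∀ n, TopologicalSpace (E n)]
    [∀ n, DiscreteTopology (E n)] {Z : Type*} [TopologicalSpace Z] {ξ : Ordinal.{0}}
    (hξ : 1 < ξ) [MetrizableSpace (∀ n, E n)] {g : Z → ∀ n, E n} (hg : IsClosedEmbedding g)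
    {s : Set Z} (hs : s ∈ SigmaZero Z ξ) : g '' s ∈ SigmaZero (∀ n, E n) ξ := by
  rcases isEmpty_or_nonempty Z with hZ | hZ
  · rw [Set.eq_empty_of_isEmpty s, Set.image_empty]
    exact SigmaZero.of_isOpen isOpen_empty
  obtain ⟨r, hr, hr', hrc⟩ := PiNat.exists_retraction_of_isClosed hg.isClosed_range
    (Set.range_nonempty g)
  have hmem : ∀ x, r x ∈ Set.range g := fun x => hr' ▸ Set.mem_range_self x
  let q : (∀ n, E n) → Z := fun x => hg.toIsEmbedding.toHomeomorph.symm ⟨r x, hmem x⟩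
  have hq : Continuous q := (Homeomorph.continuous _).comp (hrc.subtype_mk hmem)
  have hqg : ∀ z, q (g z) = z := fun z => by
    refine (Homeomorph.symm_apply_eq _).2 (Subtype.ext ?_)
    exact hr _ (Set.mem_range_self z)
  have : g '' s = Set.range g ∩ q ⁻¹' s := by
    ext x
    constructor
    · rintro ⟨z, hz, rfl⟩
      exact ⟨Set.mem_range_self z, by simpa [hqg] using hz⟩
    · rintro ⟨⟨z, rfl⟩, hz⟩
      exact ⟨z, by simpa [hqg] using hz, rfl⟩
  rw [this]
  exact SigmaZero.inter_isClosed hξ (SigmaZero.preimage hq hs) hg.isClosed_range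

section Universal

/-- `E` is the projection of a closed subset of `X × ℕ^ℕ` such that the projections of all its
basic open pieces belong to `Γ`. -/
def IsTameProjection {X : Type*} [TopologicalSpace X] (Γ : Set (Set X)) (E : Set X) : Prop :=
  ∃ F : Set (X × (ℕ → ℕ)), IsClosed F ∧ (∀ x, x ∈ E ↔ ∃ y, (x, y) ∈ F) ∧
    ∀ (s : Finset ℕ) (σ : ℕ → ℕ), {x | ∃ y, (∀ i ∈ s, y i = σ i) ∧ (x, y) ∈ F} ∈ Γ

theorem IsTameProjection.mem {X : Type*} [TopologicalSpace X] {Γ : Set (Set X)} {E : Set X}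
    (h : IsTameProjection Γ E) : E ∈ Γ := by
  obtain ⟨F, -, hE, hF⟩ := h
  convert hF ∅ 0 using 1
  ext x
  simp [hE]

theorem isTameProjection_of_isOpen {X : Type*} [TopologicalSpace X] {C : ℕ → Set X}
    (hC : ∀ n, IsClopen (C n)) : IsTameProjection {s : Set X | IsOpen s} (⋃ n, C n) := by
  have hcl : ∀ n, IsClopen {y : ℕ → ℕ | y 0 = n} := fun n =>
    (isClopen_discrete {n}).preimage (continuous_apply 0)
  refine ⟨{p | p.1 ∈ C (p.2 0)}, ?_, fun x => ?_, fun s σ => ?_⟩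
  · have : {p : X × (ℕ → ℕ) | p.1 ∈ C (p.2 0)}ᶜ = ⋃ n, ((C n)ᶜ ×ˢ {y | y 0 = n}) := by
      ext p; simp
    refine ⟨?_⟩
    rw [this]
    exact isOpen_iUnion fun n => (hC n).compl.isOpen.prod (hcl n).isOpen
  · simp only [Set.mem_iUnion, Set.mem_ofPred_eq]
    exact ⟨fun ⟨n, hn⟩ => ⟨fun _ => n, hn⟩, fun ⟨y, hy⟩ => ⟨y 0, hy⟩⟩
  · have : {x | ∃ y : ℕ → ℕ, (∀ i ∈ s, y i = σ i) ∧ (x, y) ∈ {p : X × (ℕ → ℕ) | p.1 ∈ C (p.2 0)}}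
        = ⋃ y : {y : ℕ → ℕ // ∀ i ∈ s, y i = σ i}, C (y.1 0) := by
      ext x; simp
    rw [this]
    exact isOpen_iUnion fun y => (hC _).isOpen

theorem isTameProjection_of_isClosed {X : Type*} [TopologicalSpace X] {E : Set X}
    (hE : IsClosed E) : IsTameProjection {s : Set X | IsClosed s} E := by
  refine ⟨Prod.fst ⁻¹' E, hE.preimage continuous_fst, fun x => by simp, fun s σ => ?_⟩
  have : {x | ∃ y : ℕ → ℕ, (∀ i ∈ s, y i = σ i) ∧ (x, y) ∈ Prod.fst ⁻¹' E} = E := by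
    ext x
    exact ⟨fun ⟨y, _, h⟩ => h, fun h => ⟨σ, fun _ _ => rfl, h⟩⟩
  rw [this]
  exact hE

variable {X : Type*} [TopologicalSpace X] {ξ : Ordinal.{0}}

/-- Tame projections at lower levels combine into one at level `ξ` for countable intersections. -/
theorem isTameProjection_iInter (hξ : 1 < ξ) {η : ℕ → Ordinal.{0}}
    (hη : ∀ n, 1 ≤ η n ∧ η n < ξ) {E : ℕ → Set X}
    (h : ∀ n, IsTameProjection (SigmaZero X (η n)) (E n)) :
    IsTameProjection (PiZero X ξ) (⋂ n, E n) := by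
  choose F hFc hE hF using h
  have key : ∀ (s : Finset ℕ) (σ : ℕ → ℕ),
      {x | ∃ y : ℕ → ℕ, (∀ i ∈ s, y i = σ i) ∧ ∀ n, (x, fun j => y (Nat.pair n j)) ∈ F n} =
      ⋂ n, {x | ∃ y : ℕ → ℕ, (∀ j ∈ s.preimage (Nat.pair n) (fun a _ b _ hab =>
        (Nat.pair_eq_pair.1 hab).2), y j = σ (Nat.pair n j)) ∧ (x, y) ∈ F n} := by
    intro s σ
    ext x
    simp only [Set.mem_iInter, Set.mem_ofPred_eq]
    constructor
    · rintro ⟨y, hy, h⟩ n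
      exact ⟨fun j => y (Nat.pair n j), fun j hj => hy _ (Finset.mem_preimage.1 hj), h n⟩
    · intro h
      choose y hy h using h
      refine ⟨fun i => y i.unpair.1 i.unpair.2, fun i hi => ?_, fun n => by simpa using h n⟩
      have := hy i.unpair.1 i.unpair.2
      rw [Nat.pair_unpair] at this
      exact this (Finset.mem_preimage.2 (by simpa using hi))
  refine ⟨{p | ∀ n, (p.1, fun j => p.2 (Nat.pair n j)) ∈ F n}, ?_, fun x => ?_, fun s σ => ?_⟩
  · simp only [Set.ofPred_forall]
    refine isClosed_iInter fun n => (hFc n).preimage ?_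
    fun_prop
  · have := Set.ext_iff.1 (key ∅ 0) x
    simp only [Finset.notMem_empty, false_imp_iff, implies_true, true_and, Set.mem_ofPred_eq,
      Set.mem_iInter, Finset.preimage_empty] at this
    simp only [Set.mem_ofPred_eq, this, Set.mem_iInter, hE]
  · simp only [Set.mem_ofPred_eq]
    rw [key]
    exact PiZero.iInter_nat hξ fun n => ⟨η n, (hη n).1, (hη n).2, hF n _ _⟩

/-- Tame projections at lower levels combine into one at level `ξ` for countable unions. -/
theorem isTameProjection_iUnion (hξ : 1 < ξ) {η : ℕ → Ordinal.{0}}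
    (hη : ∀ n, 1 ≤ η n ∧ η n < ξ) {E : ℕ → Set X}
    (h : ∀ n, IsTameProjection (PiZero X (η n)) (E n)) :
    IsTameProjection (SigmaZero X ξ) (⋃ n, E n) := by
  choose F hFc hE hF using h
  have key : ∀ (s : Finset ℕ) (σ : ℕ → ℕ),
      {x | ∃ y : ℕ → ℕ, (∀ i ∈ s, y i = σ i) ∧ (x, fun j => y (j + 1)) ∈ F (y 0)} =
      ⋃ n, {x | ((0 ∈ s → n = σ 0) ∧ ∃ y : ℕ → ℕ, (∀ j ∈ s.preimage (· + 1)
        (fun a _ b _ hab => by simpa using hab), y j = σ (j + 1)) ∧ (x, y) ∈ F n)} := by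
    intro s σ
    ext x
    simp only [Set.mem_iUnion, Set.mem_ofPred_eq]
    constructor
    · rintro ⟨y, hy, h⟩
      exact ⟨y 0, fun h0 => hy 0 h0, fun j => y (j + 1), fun j hj =>
        hy (j + 1) ((Finset.mem_preimage (f := (· + 1))).1 hj), h⟩
    · rintro ⟨n, h0, y, hy, h⟩
      refine ⟨fun i => Nat.casesOn i n y, fun i hi => ?_, h⟩
      cases i with
      | zero => exact h0 hi
      | succ i => exact hy i (Finset.mem_preimage.2 hi)
  refine ⟨{p | (p.1, fun j => p.2 (j + 1)) ∈ F (p.2 0)}, ?_, fun x => ?_, fun s σ => ?_⟩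
  · have : {p : X × (ℕ → ℕ) | (p.1, fun j => p.2 (j + 1)) ∈ F (p.2 0)}ᶜ =
        ⋃ n, {p | p.2 0 = n} ∩ {p | (p.1, fun j => p.2 (j + 1)) ∉ F n} := by
      ext p; simp
    refine ⟨?_⟩
    rw [this]
    refine isOpen_iUnion fun n => IsOpen.inter ?_ ?_
    · exact (isOpen_discrete {n}).preimage (f := fun p : X × (ℕ → ℕ) => p.2 0)
        ((continuous_apply 0).comp continuous_snd)
    · refine (hFc n).isOpen_compl.preimage (f := fun p : X × (ℕ → ℕ) =>
        (p.1, fun j => p.2 (j + 1))) ?_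
      fun_prop
  · have := Set.ext_iff.1 (key ∅ 0) x
    simp only [Finset.notMem_empty, false_imp_iff, implies_true, true_and, Set.mem_ofPred_eq,
      Set.mem_iUnion, Finset.preimage_empty] at this
    simp only [Set.mem_ofPred_eq, this, Set.mem_iUnion, hE]
  · simp only [Set.mem_ofPred_eq]
    rw [key]
    refine (mem_sigmaZero_iff hξ).2 ⟨_, fun n => ⟨η n, (hη n).1, (hη n).2, ?_⟩, rfl⟩
    by_cases h0 : 0 ∈ s → n = σ 0
    · have := hF n (s.preimage (· + 1) (fun a _ b _ hab => by simpa using hab))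
        (fun j => σ (j + 1))
      rw [eq_true h0]
      simp only [true_and]
      exact this
    · simp only [h0, false_and, Set.ofPred_false, Set.compl_empty]
      exact SigmaZero.univ

theorem IsTameProjection.preimage {Y : Type*} [TopologicalSpace Y] {Γ : Set (Set X)}
    {Γ' : Set (Set Y)} {E : Set X} (h : IsTameProjection Γ E) {g : Y → X} (hg : Continuous g)
    (hΓ : ∀ s ∈ Γ, g ⁻¹' s ∈ Γ') : IsTameProjection Γ' (g ⁻¹' E) := by
  obtain ⟨F, hFc, hE, hF⟩ := h
  refine ⟨{p | (g p.1, p.2) ∈ F}, hFc.preimage (by fun_prop), fun y => hE (g y),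
    fun s σ => hΓ _ (hF s σ)⟩

/-- The space of pairs of points of the Cantor space, as a space of sequences. -/
abbrev PairSeq : Type := ℕ → Fin 2 × Fin 2

/-- `e` is given by the indicator functions of a sequence of sets forming a basis. -/
def IsBasisCode {X : Type*} [TopologicalSpace X] (e : X → Cantor) : Prop :=
  Continuous e ∧ ∀ O : Set X, IsOpen O → ∃ c : Cantor, O = {x | ∃ n, c n = 1 ∧ e x n = 1}

/-- `U` parametrizes the `Σ⁰_ξ` subsets of every space having a basis code. -/
def IsUniversal (ξ : Ordinal.{0}) (U : Set PairSeq) : Prop :=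
  ∀ (X : Type) [TopologicalSpace X] (e : X → Cantor), IsBasisCode e →
    ∀ S ∈ SigmaZero X ξ, ∃ c : Cantor, S = {x | (fun n => (c n, e x n)) ∈ U}

theorem exists_isUniversal_one {ξ : Ordinal.{0}} (hξ : ξ ≤ 1) :
    ∃ U : Set PairSeq, IsUniversal ξ U ∧ IsTameProjection (SigmaZero PairSeq ξ) U ∧
      IsTameProjection (PiZero PairSeq ξ) Uᶜ := by
  have hcl : ∀ n, IsClopen {x : PairSeq | (x n).1 = 1 ∧ (x n).2 = 1} := fun n =>
    (isClopen_discrete {p : Fin 2 × Fin 2 | p.1 = 1 ∧ p.2 = 1}).preimage (continuous_apply n)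
  have hU : IsOpen (⋃ n, {x : PairSeq | (x n).1 = 1 ∧ (x n).2 = 1}) :=
    isOpen_iUnion fun n => (hcl n).isOpen
  have hS : SigmaZero PairSeq ξ = {s | IsOpen s} := by
    ext s; exact mem_sigmaZero_of_le_one hξ
  have hP : PiZero PairSeq ξ = {s | IsClosed s} := by
    ext s; exact (mem_sigmaZero_of_le_one hξ).trans isOpen_compl_iff
  refine ⟨⋃ n, {x | (x n).1 = 1 ∧ (x n).2 = 1}, fun X _ e he S hS => ?_, ?_, ?_⟩
  · obtain ⟨c, hc⟩ := he.2 S ((mem_sigmaZero_of_le_one hξ).1 hS)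
    exact ⟨c, by rw [hc]; ext x; simp⟩
  · rw [hS]
    exact isTameProjection_of_isOpen hcl
  · rw [hP]
    exact isTameProjection_of_isClosed hU.isClosed_compl

theorem countable_Iio_of_card_le {ξ : Ordinal.{0}} (h : ξ.card ≤ Cardinal.aleph0) :
    (Set.Iio ξ).Countable := by
  rw [← Cardinal.le_aleph0_iff_set_countable, Cardinal.mk_Iio_ordinal,
    ← Cardinal.lift_aleph0.{1, 0},
    Cardinal.lift_le]
  exact h

theorem exists_isUniversal (ξ : Ordinal.{0}) (hξ : ξ.card ≤ Cardinal.aleph0) :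
    ∃ U : Set PairSeq, IsUniversal ξ U ∧ IsTameProjection (SigmaZero PairSeq ξ) U ∧
      IsTameProjection (PiZero PairSeq ξ) Uᶜ := by
  induction ξ using WellFoundedLT.induction with
  | ind ξ ih =>
    rcases le_or_gt ξ 1 with h1 | h1
    · exact exists_isUniversal_one h1
    obtain ⟨η, hη⟩ : ∃ η : ℕ → Ordinal.{0}, Set.Ico 1 ξ = Set.range η :=
      ((countable_Iio_of_card_le hξ).mono fun x hx => hx.2).exists_eq_range ⟨1, le_rfl, h1⟩
    have hη' : ∀ m, 1 ≤ η m ∧ η m < ξ := fun m => by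
      have : η m ∈ Set.Ico 1 ξ := hη ▸ Set.mem_range_self m
      exact this
    choose V hV hVS hVP using fun m =>
      ih (η m) (hη' m).2 ((Ordinal.card_le_card (hη' m).2.le).trans hξ)
    let g : ℕ → PairSeq → PairSeq := fun n x j => ((x (Nat.pair n j)).1, (x j).2)
    have hg : ∀ n, Continuous (g n) := fun n => by fun_prop
    have hS : IsTameProjection (SigmaZero PairSeq ξ) (⋃ n, g n ⁻¹' (V n.unpair.1)ᶜ) :=
      isTameProjection_iUnion h1 (fun n => hη' n.unpair.1) fun n =>
        (hVP n.unpair.1).preimage (hg n) fun s hs => SigmaZero.preimage (hg n) hs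
    have hP : IsTameProjection (PiZero PairSeq ξ) (⋃ n, g n ⁻¹' (V n.unpair.1)ᶜ)ᶜ := by
      simp only [Set.compl_iUnion, Set.preimage_compl, compl_compl]
      exact isTameProjection_iInter h1 (fun n => hη' n.unpair.1) fun n =>
        (hVS n.unpair.1).preimage (hg n) fun s hs => SigmaZero.preimage (hg n) hs
    refine ⟨_, fun X _ e he S hSS => ?_, hS, hP⟩
    obtain ⟨f, hf, rfl⟩ := (mem_sigmaZero_iff h1).1 hSS
    have hex : ∀ n : ℕ, ∃ c : Cantor,
        ((f n.unpair.2)ᶜ ∈ SigmaZero X (η n.unpair.1) → f n.unpair.2 =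
          {x | (fun j => (c j, e x j)) ∉ V n.unpair.1}) ∧
        ((f n.unpair.2)ᶜ ∉ SigmaZero X (η n.unpair.1) → ∅ =
          {x | (fun j => (c j, e x j)) ∉ V n.unpair.1}) := by
      intro n
      by_cases h : (f n.unpair.2)ᶜ ∈ SigmaZero X (η n.unpair.1)
      · obtain ⟨c, hc⟩ := hV n.unpair.1 X e he _ h
        exact ⟨c, fun _ => by rw [← compl_compl (f _), hc]; rfl, fun h' => absurd h h'⟩
      · obtain ⟨c, hc⟩ := hV n.unpair.1 X e he _ SigmaZero.univ
        exact ⟨c, fun h' => absurd h' h, fun _ => Set.compl_univ.symm.trans (by rw [hc]; rfl)⟩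
    choose c hc hc' using hex
    refine ⟨fun i => c i.unpair.1 i.unpair.2, ?_⟩
    ext x
    simp only [Set.mem_iUnion, Set.mem_ofPred_eq, Set.mem_preimage, Set.mem_compl_iff, g,
      Nat.unpair_pair]
    constructor
    · rintro ⟨k, hk⟩
      obtain ⟨ζ, hζ1, hζ2, hζ⟩ := hf k
      obtain ⟨m, rfl⟩ : ζ ∈ Set.range η := hη ▸ ⟨hζ1, hζ2⟩
      refine ⟨Nat.pair m k, ?_⟩
      have := hc (Nat.pair m k)
      simp only [Nat.unpair_pair] at this ⊢
      have := this hζ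
      rw [this] at hk
      exact hk
    · rintro ⟨n, hn⟩
      by_cases h : (f n.unpair.2)ᶜ ∈ SigmaZero X (η n.unpair.1)
      · refine ⟨n.unpair.2, ?_⟩
        rw [hc n h]
        exact hn
      · have : x ∈ (∅ : Set X) := by
          rw [hc' n h]
          exact hn
        exact this.elim

theorem exists_isBasisCode {X : Type*} [TopologicalSpace X] [SecondCountableTopology X]
    {b : Set (Set X)} (hb : IsTopologicalBasis b) (hcl : ∀ s ∈ b, IsClopen s) :
    ∃ e : X → Cantor, IsBasisCode e := by
  classical
  obtain ⟨s, hsb, hs, hsB⟩ := hb.exists_countable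
  obtain ⟨C, hC⟩ : ∃ C : ℕ → Set X, insert ∅ s = Set.range C :=
    (hs.insert ∅).exists_eq_range (Set.insert_nonempty _ _)
  have hCcl : ∀ n, IsClopen (C n) := fun n => by
    have : C n ∈ insert ∅ s := hC ▸ Set.mem_range_self n
    rcases this with h | h
    · rw [h]; exact isClopen_empty
    · exact hcl _ (hsb h)
  refine ⟨fun x n => if x ∈ C n then 1 else 0, continuous_pi fun n => ?_, fun O hO => ?_⟩
  · refine Continuous.if (fun a ha => ?_) continuous_const continuous_const
    have : a ∈ frontier (C n) := ha
    rw [(hCcl n).frontier_eq] at this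
    exact this.elim
  · refine ⟨fun n => if C n ⊆ O then 1 else 0, ?_⟩
    ext x
    constructor
    · intro hx
      obtain ⟨t, ht, hxt, htO⟩ := hsB.exists_subset_of_mem_open hx hO
      obtain ⟨n, rfl⟩ : t ∈ Set.range C := hC ▸ Set.mem_insert_of_mem _ ht
      exact ⟨n, by simp [htO], by simp [hxt]⟩
    · rintro ⟨n, h1, h2⟩
      simp only [ite_eq_left_iff, zero_ne_one, imp_false, not_not] at h1 h2
      exact h1 h2

theorem exists_isBasisCode_cantor : ∃ e : Cantor → Cantor, IsBasisCode e :=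
  exists_isBasisCode isTopologicalBasis_isClopen fun _ h => h

/-- A preimage of a universal set under a diagonal map is not `Π⁰_ξ`. -/
theorem IsUniversal.diagonal_notMem_piZero {ξ : Ordinal.{0}} {U : Set PairSeq}
    (hU : IsUniversal ξ U) {e : Cantor → Cantor} (he : IsBasisCode e) :
    {x : Cantor | (fun n => (x n, e x n)) ∈ U} ∉ PiZero Cantor ξ := by
  intro h
  obtain ⟨c, hc⟩ := hU Cantor e he _ h
  have := Set.ext_iff.1 hc c
  simp only [Set.mem_compl_iff, Set.mem_ofPred_eq] at this
  tauto

end Universal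

section Words

variable {β : Type*}

/-- The infinite word with first letter `a` followed by `z`. -/
def seqCons (a : β) (z : ℕ → β) : ℕ → β := fun n => Nat.casesOn n a z

/-- The infinite word `w` followed by `z`. -/
def seqAppend (w : List β) (z : ℕ → β) : ℕ → β := w.foldr seqCons z

theorem seqCons_injective {a b : β} {y z : ℕ → β} (h : seqCons a y = seqCons b z) :
    a = b ∧ y = z :=
  ⟨congrFun h 0, funext fun n => congrFun h (n + 1)⟩

@[simp] theorem seqAppend_nil (z : ℕ → β) : seqAppend [] z = z := rfl

@[simp] theorem seqAppend_cons (a : β) (w : List β) (z : ℕ → β) :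
    seqAppend (a :: w) z = seqCons a (seqAppend w z) := rfl

theorem seqAppend_append (v w : List β) (z : ℕ → β) :
    seqAppend (v ++ w) z = seqAppend v (seqAppend w z) := List.foldr_append

theorem seqAppend_apply_add (w : List β) (z : ℕ → β) (n : ℕ) :
    seqAppend w z (w.length + n) = z n := by
  induction w with
  | nil => simp
  | cons a w ih =>
    rw [List.length_cons, Nat.add_right_comm]
    exact ih

theorem seqAppend_apply_lt (w : List β) (z : ℕ → β) {n : ℕ} (h : n < w.length) :
    seqAppend w z n = w[n] := by
  induction w generalizing n with
  | nil => simp at h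
  | cons a w ih =>
    cases n with
    | zero => rfl
    | succ n => exact ih (Nat.lt_of_succ_lt_succ h)

theorem seqAppend_left_injective (w : List β) {y z : ℕ → β} (h : seqAppend w y = seqAppend w z) :
    y = z :=
  funext fun n => by rw [← seqAppend_apply_add w y, h, seqAppend_apply_add]

theorem eq_seqAppend_iff {w : List β} {y z : ℕ → β} :
    y = seqAppend w z ↔ (∀ (n : ℕ) (h : n < w.length), w[n] = y n) ∧
      z = fun n => y (w.length + n) := by
  constructor
  · rintro rfl
    exact ⟨fun n h => (seqAppend_apply_lt w z h).symm,
      funext fun n => (seqAppend_apply_add w z n).symm⟩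
  · rintro ⟨h, rfl⟩
    funext n
    rcases lt_or_ge n w.length with hn | hn
    · rw [seqAppend_apply_lt _ _ hn, h]
    · obtain ⟨m, rfl⟩ := Nat.exists_eq_add_of_le hn
      rw [seqAppend_apply_add]

/-- The word formed by the first `n` letters of `x`. -/
def seqTake (x : ℕ → β) (n : ℕ) : List β := (List.range n).map x

@[simp] theorem length_seqTake (x : ℕ → β) (n : ℕ) : (seqTake x n).length = n := by
  simp [seqTake]

theorem seqTake_eq_iff {x y : ℕ → β} {m n : ℕ} :
    seqTake x m = seqTake y n ↔ m = n ∧ ∀ i < n, x i = y i := by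
  constructor
  · intro h
    obtain rfl : m = n := by simpa using congrArg List.length h
    refine ⟨rfl, fun i hi => ?_⟩
    simpa [seqTake, hi] using congrArg (fun l => l[i]?) h
  · rintro ⟨rfl, h⟩
    exact List.map_congr_left fun i hi => h i (List.mem_range.1 hi)

theorem eq_seqAppend_seqTake (x : ℕ → β) (n : ℕ) :
    x = seqAppend (seqTake x n) (fun i => x (n + i)) := by
  rw [eq_seqAppend_iff]
  simp [seqTake]

theorem concatPrefix_succ (a : ℕ → List β) (m : ℕ) :
    concatPrefix a (m + 1) = concatPrefix a m ++ a m := by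
  simp [concatPrefix, List.range_succ]

theorem concatPrefix_succ' (a : ℕ → List β) (m : ℕ) :
    concatPrefix a (m + 1) = a 0 ++ concatPrefix (fun i => a (i + 1)) m := by
  simp [concatPrefix, List.range_succ_eq_map, Function.comp_def]

theorem le_length_concatPrefix {a : ℕ → List β} (ha : ∀ i, a i ≠ []) (m : ℕ) :
    m ≤ (concatPrefix a m).length := by
  induction m with
  | zero => simp
  | succ m ih =>
    rw [concatPrefix_succ, List.length_append]
    have := List.length_pos_iff.2 (ha m)
    omega

theorem mem_omegaPower_of_forall_tail {A : Set (List β)} {w : ℕ → List β} {z : ℕ → ℕ → β}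
    (hA : ∀ i, w i ∈ A) (hw : ∀ i, w i ≠ []) (hz : ∀ i, z i = seqAppend (w i) (z (i + 1))) :
    z 0 ∈ omegaPower A := by
  have key : ∀ m, z 0 = seqAppend (concatPrefix w m) (z m) := by
    intro m
    induction m with
    | zero => rfl
    | succ m ih => rw [concatPrefix_succ, seqAppend_append, ← hz, ih]
  exact ⟨w, hA, fun n => ⟨n, le_length_concatPrefix hw n⟩,
    fun m k h => (eq_seqAppend_iff.1 (key m)).1 k h⟩

theorem exists_tail_of_mem_omegaPower {A : Set (List β)} {y : ℕ → β} (hy : y ∈ omegaPower A) :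
    ∃ (w : ℕ → List β) (z : ℕ → ℕ → β), (∀ i, w i ∈ A) ∧ z 0 = y ∧
      ∀ i, z i = seqAppend (w i) (z (i + 1)) := by
  obtain ⟨w, hA, -, h⟩ := hy
  refine ⟨w, fun i n => y ((concatPrefix w i).length + n), hA, by simp [concatPrefix], fun i => ?_⟩
  have key : ∀ m, y = seqAppend (concatPrefix w m) (fun n => y ((concatPrefix w m).length + n)) :=
    fun m => eq_seqAppend_iff.2 ⟨h m, rfl⟩
  apply seqAppend_left_injective (concatPrefix w i)
  rw [← key, ← seqAppend_append, ← concatPrefix_succ, ← key]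

theorem mem_omegaPower_of_coinduction {A : Set (List β)} (Q : (ℕ → β) → Prop)
    (hQ : ∀ z, Q z → ∃ w ∈ A, w ≠ [] ∧ ∃ z', z = seqAppend w z' ∧ Q z') {y : ℕ → β} (hy : Q y) :
    y ∈ omegaPower A := by
  choose! w hw hne t ht hQt using hQ
  have hQi : ∀ i, Q (t^[i] y) := fun i => by
    induction i with
    | zero => exact hy
    | succ i ih => rw [Function.iterate_succ_apply']; exact hQt _ ih
  refine mem_omegaPower_of_forall_tail (w := fun i => w (t^[i] y)) (z := fun i => t^[i] y)
    (fun i => hw _ (hQi i)) (fun i => hne _ (hQi i)) fun i => ?_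
  rw [Function.iterate_succ_apply']
  exact ht _ (hQi i)

/-- The concatenation of an infinite sequence of nonempty words. -/
def seqConcat [Inhabited β] (w : ℕ → List β) : ℕ → β :=
  fun n => (concatPrefix w (n + 1)).getD n default

theorem seqConcat_eq_seqAppend [Inhabited β] {w : ℕ → List β} (hw : ∀ i, w i ≠ []) :
    seqConcat w = seqAppend (w 0) (seqConcat fun i => w (i + 1)) := by
  have hpre : ∀ (v : ℕ → List β) (m k : ℕ), concatPrefix v m <+: concatPrefix v (m + k) := by
    intro v m k
    induction k with
    | zero => exact List.prefix_rfl
    | succ k ih =>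
      rw [← Nat.add_assoc, concatPrefix_succ]
      exact ih.trans (List.prefix_append _ _)
  rw [eq_seqAppend_iff]
  constructor
  · intro n h
    rw [seqConcat, concatPrefix_succ', List.getD_append _ _ _ _ h, List.getD_eq_getElem _ _ h]
  · funext n
    have hpos := List.length_pos_iff.2 (hw 0)
    obtain ⟨k, hk⟩ : ∃ k, (w 0).length + n = n + 1 + k := ⟨(w 0).length - 1, by omega⟩
    obtain ⟨l, hl⟩ := hpre (fun i => w (i + 1)) (n + 1) k
    rw [seqConcat, seqConcat, concatPrefix_succ' w, List.getD_append_right _ _ _ _ (by omega),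
      Nat.add_sub_cancel_left, hk, ← hl, List.getD_append]
    exact le_length_concatPrefix (fun i => hw (i + 1)) (n + 1)

theorem isOpen_iff_forall_lt_eq {E : Type*} [TopologicalSpace E] [DiscreteTopology E]
    {s : Set (ℕ → E)} :
    IsOpen s ↔ ∀ x ∈ s, ∃ N, ∀ y : ℕ → E, (∀ i < N, y i = x i) → y ∈ s := by
  rw [(PiNat.isTopologicalBasis_cylinders fun _ => E).isOpen_iff]
  refine forall₂_congr fun x _ => ⟨?_, ?_⟩
  · rintro ⟨_, ⟨z, N, rfl⟩, hx, h⟩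
    exact ⟨N, fun y hy => h fun i hi => (hy i hi).trans (hx i hi)⟩
  · rintro ⟨N, h⟩
    exact ⟨_, ⟨x, N, rfl⟩, PiNat.self_mem_cylinder x N, h⟩

theorem continuous_of_forall_lt_eq {E D : Type*} [TopologicalSpace E] [DiscreteTopology E]
    [TopologicalSpace D] {g : (ℕ → E) → D} (N : ℕ)
    (h : ∀ x y : ℕ → E, (∀ i < N, y i = x i) → g y = g x) : Continuous g := by
  refine ⟨fun s _ => isOpen_iff_forall_lt_eq.2 fun x hx => ⟨N, fun y hy => ?_⟩⟩
  rw [Set.mem_preimage, h x y hy]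
  exact hx

theorem isOpen_setOf_eq_seqAppend [TopologicalSpace β] [DiscreteTopology β] (w : List β) :
    IsOpen {y : ℕ → β | ∃ z, y = seqAppend w z} := by
  refine isOpen_iff_forall_lt_eq.2 fun x ⟨z, hz⟩ => ⟨w.length, fun y hy => ?_⟩
  exact ⟨_, eq_seqAppend_iff.2 ⟨fun n hn => by rw [(eq_seqAppend_iff.1 hz).1 n hn, hy n hn], rfl⟩⟩

theorem continuous_seqCons [TopologicalSpace β] (a : β) :
    Continuous fun z : ℕ → β => seqCons a z :=
  continuous_pi fun n => by
    cases n with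
    | zero => exact continuous_const
    | succ n => exact continuous_apply n

/-- The nonempty words that are not prefixes of elements of `C`. -/
def freeWords (C : Set (ℕ → β)) : Set (List β) :=
  {w | w ≠ [] ∧ ∀ z, seqAppend w z ∉ C}

/-- If no two successive tails of a word lie in the closed set `C`, then every word outside `C`
is a concatenation of free words. -/
theorem compl_subset_omegaPower [TopologicalSpace β] [DiscreteTopology β] {C : Set (ℕ → β)}
    (hC : IsClosed C) (htail : ∀ y ∈ C, (fun n => y (n + 1)) ∉ C) {A : Set (List β)}
    (hA : freeWords C ⊆ A) : Cᶜ ⊆ omegaPower A := by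
  refine fun y hy => mem_omegaPower_of_coinduction (· ∈ Cᶜ) (fun z hz => ?_) hy
  obtain ⟨N, hN⟩ := isOpen_iff_forall_lt_eq.1 hC.isOpen_compl z hz
  have hfree : ∀ m, N < m → seqTake z m ∈ A ∧ seqTake z m ≠ [] := fun m hm => by
    have hne : seqTake z m ≠ [] := by
      rw [← List.length_pos_iff, length_seqTake]; omega
    refine ⟨hA ⟨hne, fun t => hN _ fun i hi => ?_⟩, hne⟩
    rw [seqAppend_apply_lt _ _ (by simp; omega)]
    simp [seqTake]
  by_cases h : (fun i => z (N + 1 + i)) ∈ C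
  · refine ⟨_, (hfree (N + 2) (by omega)).1, (hfree (N + 2) (by omega)).2, _,
      eq_seqAppend_seqTake z (N + 2), ?_⟩
    have := htail _ h
    convert this using 4
    omega
  · exact ⟨_, (hfree (N + 1) (by omega)).1, (hfree (N + 1) (by omega)).2, _,
      eq_seqAppend_seqTake z (N + 1), h⟩

end Words

section Blocks

variable {β : Type*} [Encodable β]

/-- A prefix code for words, starting with the letters `1, 0`. -/
def markWord (s : List β) : List (Fin 2) :=
  1 :: (List.replicate (Encodable.encode s + 1) 0 ++ [1])

theorem markWord_ne_nil (s : List β) : markWord s ≠ [] := List.cons_ne_nil _ _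

theorem seqAppend_replicate_inj {a b : ℕ} {y z : Cantor}
    (h : seqAppend (List.replicate a 0 ++ [1]) y = seqAppend (List.replicate b 0 ++ [1]) z) :
    a = b ∧ y = z := by
  induction a generalizing b with
  | zero =>
    cases b with
    | zero => exact ⟨rfl, (seqCons_injective h).2⟩
    | succ b => exact absurd (congrFun h 0) (one_ne_zero (α := Fin 2))
  | succ a ih =>
    cases b with
    | zero => exact absurd (congrFun h 0) (zero_ne_one (α := Fin 2))
    | succ b =>
      exact (ih (seqCons_injective h).2).imp_left (congrArg _)

theorem seqAppend_markWord_inj {s t : List β} {y z : Cantor}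
    (h : seqAppend (markWord s) y = seqAppend (markWord t) z) : s = t ∧ y = z := by
  obtain ⟨h1, h2⟩ := seqAppend_replicate_inj (seqCons_injective h).2
  exact ⟨Encodable.encode_injective (Nat.succ_injective h1), h2⟩

/-- The concatenation of the codes of the prefixes of `x` of length at least `k`. -/
def markSeq (k : ℕ) (x : ℕ → β) : Cantor := seqConcat fun i => markWord (seqTake x (k + i))

/-- The concatenation of the codes of the prefixes of `x` of lengths `k, …, k + n - 1`. -/
def markBlock (x : ℕ → β) : ℕ → ℕ → List (Fin 2)
  | _, 0 => []
  | k, n + 1 => markWord (seqTake x k) ++ markBlock x (k + 1) n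

theorem markSeq_eq (k : ℕ) (x : ℕ → β) :
    markSeq k x = seqAppend (markWord (seqTake x k)) (markSeq (k + 1) x) := by
  rw [markSeq, seqConcat_eq_seqAppend fun i => markWord_ne_nil _]
  simp only [markSeq, Nat.add_zero, Nat.add_assoc, Nat.add_comm 1]

theorem markSeq_zero_one (k : ℕ) (x : ℕ → β) : markSeq k x 0 = 1 ∧ markSeq k x 1 = 0 := by
  rw [markSeq_eq]
  exact ⟨rfl, rfl⟩

theorem markSeq_eq_seqAppend_markBlock (k n : ℕ) (x : ℕ → β) :
    markSeq k x = seqAppend (markBlock x k n) (markSeq (k + n) x) := by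
  induction n generalizing k with
  | zero => rfl
  | succ n ih =>
    rw [markBlock, seqAppend_append, ← Nat.add_assoc, Nat.add_right_comm, ← ih, ← markSeq_eq]

theorem seqAppend_markBlock_inj {x x' : ℕ → β} {k p n : ℕ} {z : Cantor}
    (h : seqAppend (markBlock x p (n + 1)) z = markSeq k x') :
    k = p ∧ z = markSeq (p + n + 1) x' ∧ ∀ i < p + n, x i = x' i := by
  induction n generalizing k p with
  | zero =>
    rw [markSeq_eq, markBlock, seqAppend_append] at h
    obtain ⟨h1, h2⟩ := seqAppend_markWord_inj h
    obtain ⟨rfl, h1⟩ := seqTake_eq_iff.1 h1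
    exact ⟨rfl, h2, h1⟩
  | succ n ih =>
    rw [markSeq_eq, markBlock, seqAppend_append] at h
    obtain ⟨h1, h2⟩ := seqAppend_markWord_inj h
    obtain ⟨rfl, -⟩ := seqTake_eq_iff.1 h1
    obtain ⟨-, h3, h4⟩ := ih h2
    rw [Nat.add_right_comm p 1 n] at h3 h4
    exact ⟨rfl, h3, h4⟩

theorem markSeq_inj {k k' : ℕ} {x x' : ℕ → β} (h : markSeq k x = markSeq k' x') :
    k = k' ∧ x = x' := by
  have key := fun n => seqAppend_markBlock_inj
    ((markSeq_eq_seqAppend_markBlock k (n + 1) x).symm.trans h)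
  exact ⟨(key 0).1.symm, funext fun i => (key (i + 1)).2.2 i (by omega)⟩

theorem continuous_markSeq [TopologicalSpace β] [DiscreteTopology β] (k : ℕ) :
    Continuous (markSeq k : (ℕ → β) → Cantor) := by
  refine continuous_pi fun n => continuous_of_forall_lt_eq (k + n) fun x y h => ?_
  have : concatPrefix (fun i => markWord (seqTake y (k + i))) (n + 1) =
      concatPrefix (fun i => markWord (seqTake x (k + i))) (n + 1) := by
    rw [concatPrefix, concatPrefix]
    congr 1
    refine List.map_congr_left fun i hi => ?_
    rw [List.mem_range] at hi
    rw [seqTake_eq_iff.2 ⟨rfl, fun j hj => h j (by omega)⟩]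
  rw [markSeq, markSeq, seqConcat, seqConcat, this]

variable (β) in
/-- The closure of the set of all sequences of codes. -/
def markClosure : Set Cantor := closure (⋃ k, Set.range (markSeq k : (ℕ → β) → Cantor))

theorem markSeq_mem_markClosure (k : ℕ) (x : ℕ → β) : markSeq k x ∈ markClosure β :=
  subset_closure (Set.mem_iUnion.2 ⟨k, x, rfl⟩)

theorem zero_one_of_mem_markClosure {y : Cantor} (hy : y ∈ markClosure β) : y 0 = 1 ∧ y 1 = 0 := by
  have hc : IsClosed {y : Cantor | y 0 = 1 ∧ y 1 = 0} :=
    (isClosed_eq (continuous_apply 0) continuous_const).inter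
      (isClosed_eq (continuous_apply 1) continuous_const)
  exact closure_minimal (Set.iUnion_subset fun k => Set.range_subset_iff.2 (markSeq_zero_one k))
    hc hy

theorem tail_notMem_markClosure {y : Cantor} (hy : y ∈ markClosure β) :
    (fun n => y (n + 1)) ∉ markClosure β := fun h =>
  zero_ne_one ((zero_one_of_mem_markClosure hy).2.symm.trans (zero_one_of_mem_markClosure h).1)

variable [TopologicalSpace β] [DiscreteTopology β] [Finite β]

theorem isClosedEmbedding_markSeq (k : ℕ) :
    IsClosedEmbedding (markSeq k : (ℕ → β) → Cantor) :=
  (continuous_markSeq k).isClosedEmbedding fun _ _ h => (markSeq_inj h).2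

theorem exists_eq_markSeq_of_mem_markClosure {x : ℕ → β} {p n : ℕ} {z : Cantor}
    (h : seqAppend (markBlock x p (n + 1)) z ∈ markClosure β) :
    ∃ x' : ℕ → β, seqAppend (markBlock x p (n + 1)) z = markSeq p x' := by
  have h1 := (isOpen_setOf_eq_seqAppend (markBlock x p (n + 1))).inter_closure ⟨⟨z, rfl⟩, h⟩
  have h2 : {y : Cantor | ∃ z, y = seqAppend (markBlock x p (n + 1)) z} ∩
      ⋃ k, Set.range (markSeq k : (ℕ → β) → Cantor) ⊆
      Set.range (markSeq p : (ℕ → β) → Cantor) := by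
    rintro y ⟨⟨z, hz⟩, hy⟩
    obtain ⟨k, x', hx'⟩ := Set.mem_iUnion.1 hy
    obtain ⟨rfl, -⟩ := seqAppend_markBlock_inj (hz.symm.trans hx'.symm)
    exact ⟨x', hx'⟩
  obtain ⟨x', hx'⟩ := closure_minimal h2 (isClosedEmbedding_markSeq p).isClosed_range h1
  exact ⟨x', hx'.symm⟩

end Blocks

section Control

/-- An enumeration of the finite words of natural numbers in which every word occurs infinitely
often. -/
def wordEnum (n : ℕ) : List ℕ := Denumerable.ofNat (List ℕ) n.unpair.1

theorem wordEnum_zero : wordEnum 0 = [] := by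
  simp [wordEnum]

theorem exists_wordEnum_eq (t : List ℕ) (k : ℕ) : ∃ n, wordEnum (k + n + 1) = t := by
  obtain ⟨n, hn⟩ := Nat.exists_eq_add_of_le (Nat.right_le_pair (Encodable.encode t) (k + 1))
  refine ⟨n, ?_⟩
  rw [Nat.add_right_comm, ← hn, wordEnum, Nat.unpair_pair, Denumerable.ofNat_encode]

variable {β : Type*} [Encodable β] {F : Set ((ℕ → β) × (ℕ → ℕ))}

/-- The blocks between two positions that code successive prefixes of some `y` such that `(x, y)`
is in `F`, for some `x` compatible with the block. -/
def controlBlocks (F : Set ((ℕ → β) × (ℕ → ℕ))) : Set (List (Fin 2)) :=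
  {w | ∃ x y p n m, (x, y) ∈ F ∧ w = markBlock x p (n + 1) ∧ wordEnum p = seqTake y m ∧
    wordEnum (p + n + 1) = seqTake y (m + 1)}

/-- The words whose ω-power codes the projection of `F`. -/
def controlWords (F : Set ((ℕ → β) × (ℕ → ℕ))) : Set (List (Fin 2)) :=
  freeWords (markClosure β) ∪ controlBlocks F

theorem markSeq_mem_omegaPower_of_mem {x : ℕ → β} {y : ℕ → ℕ} {k m : ℕ} (h : (x, y) ∈ F)
    (hk : wordEnum k = seqTake y m) : markSeq k x ∈ omegaPower (controlWords F) := by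
  refine mem_omegaPower_of_coinduction (fun z => ∃ k m, z = markSeq k x ∧ wordEnum k = seqTake y m)
    ?_ ⟨k, m, rfl, hk⟩
  rintro _ ⟨k, m, rfl, hk⟩
  obtain ⟨n, hn⟩ := exists_wordEnum_eq (seqTake y (m + 1)) k
  exact ⟨markBlock x k (n + 1), Or.inr ⟨x, y, k, n, m, h, rfl, hk, hn⟩,
    List.append_ne_nil_of_left_ne_nil (markWord_ne_nil _) _, markSeq (k + n + 1) x,
    markSeq_eq_seqAppend_markBlock k (n + 1) x, k + n + 1, m + 1, rfl, hn⟩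

theorem tendsto_of_forall_lt_eq {D : Type*} [TopologicalSpace D] [DiscreteTopology D]
    {u : ℕ → ℕ → D} {x : ℕ → D} (h : ∀ j, ∃ N, ∀ i ≥ N, u i j = x j) :
    Filter.Tendsto u Filter.atTop (𝓝 x) := by
  refine tendsto_pi_nhds.2 fun j => ?_
  obtain ⟨N, hN⟩ := h j
  exact tendsto_const_nhds.congr' ((Filter.eventually_ge_atTop N).mono fun i hi => (hN i hi).symm)

theorem exists_mem_of_markSeq_mem_omegaPower [TopologicalSpace β] [DiscreteTopology β]
    (hF : IsClosed F) {x : ℕ → β} {k : ℕ}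
    (h : markSeq k x ∈ omegaPower (controlWords F)) :
    ∃ y m, (x, y) ∈ F ∧ wordEnum k = seqTake y m := by
  obtain ⟨w, z, hw, hz0, hz⟩ := exists_tail_of_mem_omegaPower h
  have step : ∀ i p, z i = markSeq p x → ∃ x' y n m, (x', y) ∈ F ∧ (∀ j < p + n, x' j = x j) ∧
      wordEnum p = seqTake y m ∧ wordEnum (p + n + 1) = seqTake y (m + 1) ∧
      z (i + 1) = markSeq (p + n + 1) x := by
    intro i p hp
    rcases hw i with hfree | ⟨x', y, q, n, m, hxy, hwi, h1, h2⟩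
    · refine absurd (markSeq_mem_markClosure p x) ?_
      rw [← hp, hz]
      exact hfree.2 _
    · rw [hz, hwi] at hp
      obtain ⟨rfl, h3, h4⟩ := seqAppend_markBlock_inj hp
      exact ⟨x', y, n, m, hxy, h4, h1, h2, h3⟩
  have : Nonempty (ℕ → β) := ⟨x⟩
  choose! X Y N M hF' hX h1 h2 h3 using step
  obtain ⟨K, hK0, hK⟩ : ∃ K : ℕ → ℕ, K 0 = k ∧ ∀ i, K (i + 1) = K i + N i (K i) + 1 :=
    ⟨fun i => Nat.rec k (fun i p => p + N i p + 1) i, rfl, fun _ => rfl⟩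
  have hzK : ∀ i, z i = markSeq (K i) x := fun i => by
    induction i with
    | zero => rw [hz0, hK0]
    | succ i ih => rw [hK]; exact h3 i _ ih
  obtain ⟨m₀, hm₀⟩ : ∃ m₀, M 0 (K 0) = m₀ := ⟨_, rfl⟩
  have hstep : ∀ i, M (i + 1) (K (i + 1)) = M i (K i) + 1 ∧
      ∀ j < M i (K i) + 1, Y (i + 1) (K (i + 1)) j = Y i (K i) j := fun i => by
    have := (h1 (i + 1) _ (hzK (i + 1))).symm
    rw [hK, h2 i _ (hzK i), ← hK] at this
    exact seqTake_eq_iff.1 this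
  have hM : ∀ i, M i (K i) = m₀ + i := fun i => by
    induction i with
    | zero => exact hm₀
    | succ i ih => rw [(hstep i).1, ih, Nat.add_assoc]
  have hKi : ∀ i, i ≤ K i := fun i => by
    induction i with
    | zero => exact Nat.zero_le _
    | succ i ih => rw [hK]; omega
  have hY : ∀ j i, Y (j + i) (K (j + i)) j = Y j (K j) j := fun j i => by
    induction i with
    | zero => rfl
    | succ i ih =>
      rw [← ih]
      exact (hstep (j + i)).2 j (by rw [hM]; omega)
  have hY0 : ∀ i, ∀ j < m₀, Y i (K i) j = Y 0 (K 0) j := fun i j hj => by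
    induction i with
    | zero => rfl
    | succ i ih =>
      rw [← ih]
      exact (hstep i).2 j (by rw [hM]; omega)
  refine ⟨fun j => Y j (K j) j, m₀, ?_, ?_⟩
  · refine hF.mem_of_tendsto (f := fun i => (X i (K i), Y i (K i))) (b := Filter.atTop)
      (Filter.Tendsto.prodMk_nhds (tendsto_of_forall_lt_eq fun j => ?_)
        (tendsto_of_forall_lt_eq fun j => ?_))
      (Filter.Eventually.of_forall fun i => hF' i _ (hzK i))
    · refine ⟨j + 1, fun i hi => hX i _ (hzK i) j ?_⟩
      have := hKi i
      omega
    · refine ⟨j, fun i hi => ?_⟩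
      obtain ⟨i, rfl⟩ := Nat.exists_eq_add_of_le hi
      exact hY j i
  · rw [← hK0, h1 0 _ (hzK 0), hm₀, seqTake_eq_iff]
    exact ⟨rfl, fun j hj => (hY0 j j hj).symm⟩

theorem markSeq_mem_omegaPower_iff [TopologicalSpace β] [DiscreteTopology β]
    (hF : IsClosed F) {x : ℕ → β} {k : ℕ} :
    markSeq k x ∈ omegaPower (controlWords F) ↔ ∃ y m, (x, y) ∈ F ∧ wordEnum k = seqTake y m :=
  ⟨exists_mem_of_markSeq_mem_omegaPower hF,
    fun ⟨_, _, h, hk⟩ => markSeq_mem_omegaPower_of_mem h hk⟩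

theorem exists_eq_seqTake_iff {t : List ℕ} {y : ℕ → ℕ} :
    (∃ m, t = seqTake y m) ↔ ∀ i ∈ Finset.range t.length, y i = t.getD i 0 := by
  constructor
  · rintro ⟨m, rfl⟩ i hi
    have hi' : i < (seqTake y m).length := Finset.mem_range.1 hi
    rw [List.getD_eq_getElem _ _ hi']
    simp [seqTake]
  · intro h
    refine ⟨t.length, List.ext_getElem (by simp) fun i h1 h2 => ?_⟩
    rw [← List.getD_eq_getElem t 0 h1, ← h i (Finset.mem_range.2 h1)]
    simp [seqTake]

theorem omegaPower_controlWords_eq [TopologicalSpace β] [DiscreteTopology β] [Finite β]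
    (hF : IsClosed F) : omegaPower (controlWords F) = (markClosure β)ᶜ ∪
      ⋃ k, markSeq k '' {x | ∃ y, (∀ i ∈ Finset.range (wordEnum k).length,
        y i = (wordEnum k).getD i 0) ∧ (x, y) ∈ F} := by
  have key : ∀ (k : ℕ) (x : ℕ → β), markSeq k x ∈ omegaPower (controlWords F) ↔
      ∃ y, (∀ i ∈ Finset.range (wordEnum k).length, y i = (wordEnum k).getD i 0) ∧
        (x, y) ∈ F := by
    intro k x
    rw [markSeq_mem_omegaPower_iff hF]
    simp only [← exists_eq_seqTake_iff, ← exists_and_right, and_comm]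
  refine Set.Subset.antisymm (fun u hu => ?_) (Set.union_subset ?_ (Set.iUnion_subset fun k => ?_))
  · refine or_iff_not_imp_left.2 fun hC => ?_
    rw [Set.notMem_compl_iff] at hC
    obtain ⟨w, z, hw, rfl, hz⟩ := exists_tail_of_mem_omegaPower hu
    rcases hw 0 with hfree | ⟨x', y, q, n, m, hxy, hw0, h1, h2⟩
    · rw [hz] at hC
      exact absurd hC (hfree.2 _)
    · have hz0 := hz 0
      rw [hw0] at hz0
      rw [hz0] at hC
      obtain ⟨x, hx⟩ := exists_eq_markSeq_of_mem_markClosure hC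
      rw [← hz0] at hx
      rw [hx, key] at hu
      exact Set.mem_iUnion.2 ⟨q, x, hu, hx.symm⟩
  · exact compl_subset_omegaPower isClosed_closure (fun _ => tail_notMem_markClosure)
      Set.subset_union_left
  · rintro _ ⟨x, hx, rfl⟩
    exact (key k x).2 hx

/-- Every tame projection at level `ξ ≥ 2` is a continuous preimage of a `Σ⁰_ξ` ω-power. -/
theorem IsTameProjection.exists_omegaPower [TopologicalSpace β] [DiscreteTopology β] [Finite β]
    {ξ : Ordinal.{0}} (hξ : 1 < ξ) {U : Set (ℕ → β)}
    (hU : IsTameProjection (SigmaZero (ℕ → β) ξ) U) :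
    ∃ (A : Set (List (Fin 2))) (h : (ℕ → β) → Cantor), omegaPower A ∈ SigmaZero Cantor ξ ∧
      Continuous h ∧ U = h ⁻¹' omegaPower A := by
  obtain ⟨F, hF, hUF, hFσ⟩ := hU
  refine ⟨controlWords F, markSeq 0, ?_, continuous_markSeq 0, ?_⟩
  · rw [omegaPower_controlWords_eq hF]
    exact SigmaZero.union (SigmaZero.of_isOpen isClosed_closure.isOpen_compl)
      (SigmaZero.iUnion_nat fun k => SigmaZero.image hξ (isClosedEmbedding_markSeq k) (hFσ _ _))
  · ext x
    rw [Set.mem_preimage, markSeq_mem_omegaPower_iff hF, hUF, wordEnum_zero]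
    exact exists_congr fun y => ⟨fun h => ⟨0, h, rfl⟩, fun ⟨_, h, _⟩ => h⟩

end Control

/-- The complement of a point differing from its own tail is an ω-power. -/
theorem exists_omegaPower_eq_compl_singleton {γ : Cantor} (hγ : (fun n => γ (n + 1)) ≠ γ) :
    ∃ A : Set (List (Fin 2)), omegaPower A = {γ}ᶜ := by
  refine ⟨freeWords {γ}, Set.Subset.antisymm ?_
    (compl_subset_omegaPower isClosed_singleton ?_ Set.Subset.rfl)⟩
  · rintro y hy rfl
    obtain ⟨w, z, hw, h0, hz⟩ := exists_tail_of_mem_omegaPower hy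
    exact (hw 0).2 (z 1) (by rw [← hz, h0, Set.mem_singleton_iff])
  · rintro _ rfl
    exact hγ

/-- Every open subset of the space of pair sequences is a continuous preimage of an open
ω-power. -/
theorem exists_omegaPower_of_isOpen {U : Set PairSeq} (hU : IsOpen U) :
    ∃ (A : Set (List (Fin 2))) (h : PairSeq → Cantor), IsOpen (omegaPower A) ∧
      Continuous h ∧ U = h ⁻¹' omegaPower A := by
  obtain ⟨e, he⟩ := exists_isBasisCode (X := PairSeq) isTopologicalBasis_isClopen fun _ h => h
  obtain ⟨c, hc⟩ := he.2 U hU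
  obtain ⟨A, hA⟩ := exists_omegaPower_eq_compl_singleton (γ := seqCons 1 0)
    fun h => zero_ne_one (congrFun h 0)
  refine ⟨A, fun x => seqCons 1 fun n => c n * e x n, hA ▸ isOpen_compl_singleton,
    (continuous_seqCons 1).comp (continuous_pi fun n => continuous_const.mul
      ((continuous_apply n).comp he.1)), ?_⟩
  have h2 : ∀ a b : Fin 2, a = 1 ∧ b = 1 ↔ a * b ≠ 0 := by decide
  ext x
  rw [hA, hc, Set.mem_preimage, Set.mem_compl_iff, Set.mem_singleton_iff, Set.mem_ofPred_eq]
  simp only [h2, ← not_forall, ne_eq]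
  refine not_congr ⟨fun h => congrArg _ (funext h), fun h n => congrFun (seqCons_injective h).2 n⟩

/-- For every countable ordinal ξ ≥ 1 there is a set A of finite binary words whose
ω-power is Σ⁰_ξ-complete; in particular A^∞ ∈ Σ⁰_ξ(2^ω) \ Π⁰_ξ(2^ω). -/
theorem sigma_complete_omega_power (ξ : Ordinal.{0}) (hξ : 1 ≤ ξ)
    (hcount : ξ.card ≤ Cardinal.aleph0) :
    ∃ A : Set (List (Fin 2)),
      omegaPower A ∈ SigmaZero Cantor ξ ∧
      (∀ (X : Type) [TopologicalSpace X] [PolishSpace X], ZeroDim X →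
        ∀ S ∈ SigmaZero X ξ, ∃ f : X → Cantor, Continuous f ∧ S = f ⁻¹' omegaPower A) ∧
      omegaPower A ∉ PiZero Cantor ξ := by
  obtain ⟨U, hU, htame, -⟩ := exists_isUniversal ξ hcount
  obtain ⟨A, h, hA, hh, rfl⟩ : ∃ (A : Set (List (Fin 2))) (h : PairSeq → Cantor),
      omegaPower A ∈ SigmaZero Cantor ξ ∧ Continuous h ∧ U = h ⁻¹' omegaPower A := by
    rcases hξ.eq_or_lt with rfl | hξ
    · obtain ⟨A, h, hA, hh⟩ :=
        exists_omegaPower_of_isOpen ((mem_sigmaZero_of_le_one le_rfl).1 htame.mem)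
      exact ⟨A, h, (mem_sigmaZero_of_le_one le_rfl).2 hA, hh⟩
    · exact htame.exists_omegaPower hξ
  refine ⟨A, hA, fun X _ _ ⟨b, hb, hcl⟩ S hS => ?_, fun hP => ?_⟩
  · obtain ⟨e, he⟩ := exists_isBasisCode hb hcl
    obtain ⟨c, hc⟩ := hU X e he S hS
    exact ⟨fun x => h fun n => (c n, e x n), hh.comp (continuous_pi fun n =>
      continuous_const.prodMk ((continuous_apply n).comp he.1)), hc⟩
  · obtain ⟨e, he⟩ := exists_isBasisCode_cantor
    refine hU.diagonal_notMem_piZero he (SigmaZero.preimage (g := fun x : Cantor =>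
      h fun n => (x n, e x n)) (hh.comp (continuous_pi fun n => ?_)) hP)
    exact (continuous_apply n).prodMk ((continuous_apply n).comp he.1)
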